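/- arXiv:math/0210306 — 2 statements merged into one kernel-verified Lean document; each statement's English description precedes it below -/
import Mathlib

section
/- Let fₙ : V → ℂ be a sequence of univalent (holomorphic injective) functions on a domain V ⊆ ℂ converging uniformly on V to a constant a, let bₙ ∈ V with fₙ(bₙ) = a, and suppose bₙ → b ∈ V. Define Fₙ(z) = (fₙ(z) - a)/fₙ'(bₙ). Then Fₙ(bₙ) = 0 and Fₙ'(bₙ) = 1, and some subsequence of (Fₙ) converges locally uniformly on V to a univalent function F with F(b) = 0 and F'(b) = 1. -/
open Filter

section Univalent

open Metric Set Topology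

/-- A nonvanishing holomorphic function on a disc has a holomorphic logarithm. -/
theorem exists_log_of_ne_zero_on_ball {h : ℂ → ℂ} {c : ℂ} {R : ℝ}
    (hd : DifferentiableOn ℂ h (ball c R)) (h0 : ∀ z ∈ ball c R, h z ≠ 0) :
    ∃ L : ℂ → ℂ, (∀ z ∈ ball c R, HasDerivAt L (deriv h z / h z) z) ∧
      ∀ z ∈ ball c R, Complex.exp (L z) = h z := by
  rcases le_or_gt R 0 with hR | hR
  · simp [ball_eq_empty.2 hR]
  have hdd : DifferentiableOn ℂ (fun z => deriv h z / h z) (ball c R) :=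
    (hd.deriv isOpen_ball).div hd h0
  obtain ⟨L, hLc, hL⟩ := hdd.isExactOn_ball.with_val_at c (Complex.log (h c))
  refine ⟨L, hL, fun z hz => ?_⟩
  have hder : ∀ w ∈ ball c R, HasDerivAt (fun w => h w * Complex.exp (-L w)) 0 w := by
    intro w hw
    have h1 := (hd.differentiableAt (isOpen_ball.mem_nhds hw)).hasDerivAt
    refine (h1.mul (hL w hw).neg.cexp).congr_deriv ?_
    have := h0 w hw
    field_simp
    ring
  have hconst := (convex_ball c R).is_const_of_fderivWithin_eq_zero (𝕜 := ℂ)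
    (f := fun w => h w * Complex.exp (-L w))
    (fun w hw => (hder w hw).differentiableAt.differentiableWithinAt)
    (fun w hw => by
      rw [fderivWithin_of_isOpen isOpen_ball hw]
      ext
      simpa using! (hder w hw).deriv) hz (mem_ball_self hR)
  have hc : h c * Complex.exp (-L c) = 1 := by
    rw [hLc, Complex.exp_neg, Complex.exp_log (h0 c (mem_ball_self hR)),
      mul_inv_cancel₀ (h0 c (mem_ball_self hR))]
  rw [hc, Complex.exp_neg] at hconst
  rwa [← div_eq_mul_inv, div_eq_one_iff_eq (Complex.exp_ne_zero _), eq_comm] at hconst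

/-- A holomorphic function that is injective near a point has nonzero derivative there. -/
theorem deriv_ne_zero_of_injOn {g : ℂ → ℂ} {c : ℂ} {U : Set ℂ} (hU : U ∈ 𝓝 c)
    (hg : AnalyticAt ℂ g c) (hinj : InjOn g U) : deriv g c ≠ 0 := by
  have hga : AnalyticAt ℂ (fun z => g z - g c) c := hg.sub analyticAt_const
  have hnc : ¬ ∀ᶠ z in 𝓝 c, g z - g c = 0 := by
    intro h
    have h' : ∀ᶠ z in 𝓝[≠] c, False := by
      filter_upwards [(h.and hU).filter_mono nhdsWithin_le_nhds, self_mem_nhdsWithin]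
        with z hz hzc
      exact hzc (hinj hz.2 (mem_of_mem_nhds hU) (sub_eq_zero.1 hz.1))
    exact h'.exists.elim fun _ => id
  obtain ⟨n, h, hh, hh0, heq⟩ := hga.exists_eventuallyEq_pow_smul_nonzero_iff.2 hnc
  have hev : ∀ᶠ z in 𝓝 c, z ∈ U ∧ g z - g c = (z - c) ^ n * h z ∧ h z ≠ 0 ∧
      DifferentiableAt ℂ h z := by
    filter_upwards [hU, heq, hh.continuousAt.eventually_ne hh0, hh.eventually_analyticAt]
      with z h1 h2 h3 h4
    exact ⟨h1, by simpa using h2, h3, h4.differentiableAt⟩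
  obtain ⟨r, hr, hball⟩ := Metric.eventually_nhds_iff_ball.1 hev
  obtain ⟨L, hL, hexp⟩ := exists_log_of_ne_zero_on_ball (h := h) (c := c) (R := r)
    (fun z hz => (hball z hz).2.2.2.differentiableWithinAt) (fun z hz => (hball z hz).2.2.1)
  have hn : n ≠ 0 := by
    rintro rfl
    have := (hball c (mem_ball_self hr)).2.1
    simp [hh0.symm] at this
  have hn' : (n : ℂ) ≠ 0 := Nat.cast_ne_zero.2 hn
  set p : ℂ → ℂ := fun z => (z - c) * Complex.exp (L z / n) with hp
  have hpd : DifferentiableOn ℂ p (ball c r) := fun z hz =>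
    ((differentiableAt_id.sub_const c).mul
      ((hL z hz).differentiableAt.div_const _).cexp).differentiableWithinAt
  have hpow : ∀ z ∈ ball c r, g z - g c = p z ^ n := by
    intro z hz
    rw [hp, mul_pow, ← Complex.exp_nat_mul, mul_div_cancel₀ _ hn', hexp z hz,
      (hball z hz).2.1]
  have hpc : p c = 0 := by simp [hp]
  have hpinj : InjOn p (ball c r) := fun x hx y hy hxy =>
    hinj (hball x hx).1 (hball y hy).1 (sub_left_injective
      ((hpow x hx).trans ((congrArg (· ^ n) hxy).trans (hpow y hy).symm)))
  have hpa : AnalyticAt ℂ p c := hpd.analyticAt (ball_mem_nhds c hr)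
  have hopen : 𝓝 (p c) ≤ map p (𝓝 c) := by
    refine hpa.eventually_constant_or_nhds_le_map_nhds.resolve_left fun h => ?_
    have h' : ∀ᶠ z in 𝓝[≠] c, False := by
      filter_upwards [(h.and (ball_mem_nhds c hr)).filter_mono nhdsWithin_le_nhds,
        self_mem_nhdsWithin] with z hz hzc
      exact hzc (hpinj hz.2 (mem_ball_self hr) hz.1)
    exact h'.exists.elim fun _ => id
  have himg : p '' ball c r ∈ 𝓝 (0 : ℂ) := by
    rw [← hpc]
    exact hopen (image_mem_map (ball_mem_nhds c hr))
  have hζ := Complex.isPrimitiveRoot_exp n hn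
  set ζ := Complex.exp (2 * Real.pi * Complex.I / n)
  have himg' : ∀ᶠ u in 𝓝 (0 : ℂ), ζ * u ∈ p '' ball c r := by
    have : Tendsto (fun u => ζ * u) (𝓝 0) (𝓝 0) := by
      simpa using! (continuous_const_mul ζ).tendsto 0
    exact this himg
  have : ∃ u : ℂ, (u ∈ p '' ball c r ∧ ζ * u ∈ p '' ball c r) ∧ u ≠ 0 :=
    ((((show ∀ᶠ u in 𝓝 (0 : ℂ), u ∈ p '' ball c r from himg).and himg').filter_mono nhdsWithin_le_nhds).and
      (self_mem_nhdsWithin : {0}ᶜ ∈ 𝓝[≠] (0 : ℂ))).exists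
  obtain ⟨u, ⟨⟨x, hx, hxu⟩, ⟨y, hy, hyu⟩⟩, hu⟩ := this
  have hxy : x = y := by
    refine hinj (hball x hx).1 (hball y hy).1 (sub_left_injective (b := g c) ?_)
    simp only [hpow x hx, hpow y hy, hxu, hyu, mul_pow, hζ.pow_eq_one, one_mul]
  subst hxy
  have hζ1 : ζ = 1 := mul_right_cancel₀ hu (by rw [one_mul, ← hyu, hxu])
  have hn1 : n = 1 := by
    rw [hζ1] at hζ
    exact hζ.unique IsPrimitiveRoot.one
  subst hn1
  have hder : HasDerivAt (fun z => g c + (z - c) * h z) (h c) c := by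
    simpa using! (((hasDerivAt_id c).sub_const c).mul
      hh.differentiableAt.hasDerivAt).const_add (g c)
  have : deriv g c = h c := by
    refine (hder.congr_of_eventuallyEq ?_).deriv
    filter_upwards [hev] with z hz
    linear_combination hz.2.1
  rwa [this]

/-- A version of Bloch's theorem. -/
theorem exists_ball_subset_image_of_differentiableOn {f : ℂ → ℂ} {c : ℂ} {R : ℝ} (hR : 0 < R)
    (hd : DifferentiableOn ℂ f (ball c R)) (h0 : deriv f c ≠ 0) :
    ∃ p, ball p (R * ‖deriv f c‖ / 96) ⊆ f '' ball c R := by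
  have hdd := hd.deriv isOpen_ball
  have hsub : closedBall c (R / 2) ⊆ ball c R := closedBall_subset_ball (by linarith)
  have hcont : ContinuousOn (fun z => ‖deriv f z‖ * (R / 2 - dist z c)) (closedBall c (R / 2)) :=
    (hdd.continuousOn.mono hsub).norm.mul (by fun_prop)
  obtain ⟨a, ha, hmax⟩ := (isCompact_closedBall c (R / 2)).exists_isMaxOn
    ⟨c, mem_closedBall_self (by linarith)⟩ hcont
  have hac : ‖deriv f c‖ * (R / 2) ≤ ‖deriv f a‖ * (R / 2 - dist a c) := by
    simpa using hmax (mem_closedBall_self (by linarith : 0 ≤ R / 2))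
  have hfc : 0 < ‖deriv f c‖ := norm_pos_iff.2 h0
  rw [mem_closedBall] at ha
  have hpos : 0 < ‖deriv f a‖ * (R / 2 - dist a c) := lt_of_lt_of_le (by positivity) hac
  have hfa : 0 < ‖deriv f a‖ := pos_of_mul_pos_left hpos (by linarith)
  obtain ⟨t, ht⟩ : ∃ t, t = (R / 2 - dist a c) / 2 := ⟨_, rfl⟩
  have ht0 : 0 < t := by
    have := pos_of_mul_pos_right hpos hfa.le
    linarith
  have hball : ball a t ⊆ ball c (R / 2) := ball_subset_ball' (by linarith)
  have hballR : ball a t ⊆ ball c R := hball.trans (ball_subset_ball (by linarith))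
  have hbd : ∀ z ∈ ball a t, ‖deriv f z‖ ≤ 2 * ‖deriv f a‖ := by
    intro z hz
    have h1 : ‖deriv f z‖ * (R / 2 - dist z c) ≤ ‖deriv f a‖ * (R / 2 - dist a c) :=
      hmax (ball_subset_closedBall (hball hz))
    have h2 : t ≤ R / 2 - dist z c := by
      have := dist_triangle z a c
      rw [mem_ball] at hz
      linarith
    have h3 : ‖deriv f z‖ * t ≤ 2 * ‖deriv f a‖ * t := by
      calc _ ≤ ‖deriv f z‖ * (R / 2 - dist z c) := by gcongr
        _ ≤ _ := by rw [show R / 2 - dist a c = 2 * t by linarith] at h1; linarith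
    exact le_of_mul_le_mul_right h3 ht0
  have hschwarz : ∀ z ∈ ball a t, dist (deriv f z) (deriv f a) ≤
      3 * ‖deriv f a‖ / t * dist z a := by
    intro z hz
    refine Complex.dist_le_div_mul_dist_of_mapsTo_ball (hdd.mono hballR) (fun w hw => ?_) hz
    rw [mem_closedBall, dist_eq_norm]
    linarith [norm_sub_le (deriv f w) (deriv f a), hbd w hw]
  have hs : 0 < t / 6 := by linarith
  have hsub6 : closedBall a (t / 6) ⊆ ball a t := closedBall_subset_ball (by linarith)
  have hlow : ∀ z ∈ sphere a (t / 6), ‖deriv f a‖ * t / 12 ≤ ‖f z - f a‖ := by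
    intro z hz
    have hmv := (convex_closedBall a (t / 6)).norm_image_sub_le_of_norm_hasDerivWithin_le
      (f := fun w => f w - deriv f a * w) (f' := fun w => deriv f w - deriv f a)
      (C := ‖deriv f a‖ / 2) (x := a) (y := z)
      (fun w hw => by
        have hw' := hballR (hsub6 hw)
        have := (hd.differentiableAt (isOpen_ball.mem_nhds hw')).hasDerivAt
        simpa using! (this.sub ((hasDerivAt_id w).const_mul (deriv f a))).hasDerivWithinAt)
      (fun w hw => by
        rw [← dist_eq_norm]
        refine (hschwarz w (hsub6 hw)).trans ?_
        calc 3 * ‖deriv f a‖ / t * dist w a ≤ 3 * ‖deriv f a‖ / t * (t / 6) := by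
              gcongr; exact hw
          _ = _ := by field_simp; norm_num)
      (mem_closedBall_self hs.le) (sphere_subset_closedBall hz)
    have hza : ‖z - a‖ = t / 6 := by simpa [dist_eq_norm] using hz
    rw [hza] at hmv
    have h2 : ‖deriv f a * (z - a)‖ = ‖deriv f a‖ * (t / 6) := by rw [norm_mul, hza]
    have h3 : deriv f a * (z - a) = (f z - f a) -
        (f z - deriv f a * z - (f a - deriv f a * a)) := by ring
    have h4 := norm_sub_le (f z - f a) (f z - deriv f a * z - (f a - deriv f a * a))
    rw [← h3, h2] at h4
    linarith
  have hdc : DiffContOnCl ℂ f (ball a (t / 6)) :=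
    (hd.mono (hsub6.trans hballR)).diffContOnCl_ball subset_rfl
  have hfreq : ∃ᶠ z in 𝓝 a, f z ≠ f a := by
    have hda := (hd.differentiableAt
      (isOpen_ball.mem_nhds (hballR (mem_ball_self ht0)))).hasDerivAt
    exact (hda.eventually_ne (norm_pos_iff.1 hfa)).frequently.filter_mono nhdsWithin_le_nhds
  refine ⟨f a, (ball_subset_ball ?_).trans
    ((hdc.ball_subset_image_closedBall hs hlow hfreq).trans
      (image_mono (hsub6.trans hballR)))⟩
  rw [show R / 2 - dist a c = 2 * t by linarith] at hac
  linarith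

/-- If a univalent function on a disc omits `w`, its logarithmic derivative relative to `w` at the
centre is bounded by a constant over the radius. -/
theorem norm_deriv_le_of_injOn_ball_of_notMem {g : ℂ → ℂ} {c w : ℂ} {R : ℝ} (hR : 0 < R)
    (hd : DifferentiableOn ℂ g (ball c R)) (hinj : InjOn g (ball c R))
    (hw : ∀ z ∈ ball c R, g z ≠ w) :
    ‖deriv g c / (g c - w)‖ ≤ 96 * 4 / R := by
  obtain ⟨L, hL, hexp⟩ := exists_log_of_ne_zero_on_ball (h := fun z => g z - w)
    (hd.sub_const w) (fun z hz => sub_ne_zero.2 (hw z hz))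
  have hLc := (hL c (mem_ball_self hR)).deriv
  rw [deriv_sub_const] at hLc
  by_contra! hlt
  have h0 : deriv L c ≠ 0 := by
    rw [hLc, ← norm_pos_iff]
    exact lt_trans (by positivity) hlt
  obtain ⟨p, hp⟩ := exists_ball_subset_image_of_differentiableOn hR
    (fun z hz => (hL z hz).differentiableAt.differentiableWithinAt) h0
  have hrad : 4 < R * ‖deriv L c‖ / 96 := by
    rw [hLc]
    rw [div_lt_iff₀ hR] at hlt
    linarith
  have hπ : ‖(Real.pi : ℂ) * Complex.I‖ < R * ‖deriv L c‖ / 96 := by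
    simp only [norm_mul, Complex.norm_real, Complex.norm_I, mul_one, Real.norm_eq_abs,
      abs_of_pos Real.pi_pos]
    linarith [Real.pi_le_four]
  obtain ⟨x, hx, hxp⟩ := hp (show p + Real.pi * Complex.I ∈ _ by simpa using hπ)
  obtain ⟨y, hy, hyp⟩ := hp (show p - Real.pi * Complex.I ∈ _ by simpa using hπ)
  have hxy : x = y := by
    refine hinj hx hy (sub_left_injective (b := w) ?_)
    simp only [← hexp x hx, ← hexp y hy, hxp, hyp]
    rw [Complex.exp_add, Complex.exp_sub, Complex.exp_pi_mul_I]
    ring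
  subst hxy
  have : (Real.pi : ℂ) * Complex.I = 0 := by
    have := hxp.symm.trans hyp
    linear_combination this / 2
  simp [Real.pi_ne_zero] at this

/-- If a univalent function on a disc omits `w`, its distance to `w` on the concentric disc of half
the radius is controlled by the distance at the centre. -/
theorem norm_sub_le_of_injOn_ball_of_notMem {g : ℂ → ℂ} {c w : ℂ} {R : ℝ} (hR : 0 < R)
    (hd : DifferentiableOn ℂ g (ball c R)) (hinj : InjOn g (ball c R))
    (hw : ∀ z ∈ ball c R, g z ≠ w) {z : ℂ} (hz : z ∈ ball c (R / 2)) :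
    ‖g z - w‖ ≤ Real.exp (96 * 4) * ‖g c - w‖ := by
  obtain ⟨L, hL, hexp⟩ := exists_log_of_ne_zero_on_ball (h := fun z => g z - w)
    (hd.sub_const w) (fun z hz => sub_ne_zero.2 (hw z hz))
  have hsub : ball c (R / 2) ⊆ ball c R := ball_subset_ball (by linarith)
  have hmv := (convex_ball c (R / 2)).norm_image_sub_le_of_norm_hasDerivWithin_le
    (C := 96 * 4 / (R / 2)) (fun x hx => (hL x (hsub hx)).hasDerivWithinAt)
    (fun x hx => by
      have hx' : ball x (R / 2) ⊆ ball c R := ball_subset_ball' (by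
        rw [mem_ball] at hx; linarith)
      rw [deriv_sub_const]
      exact norm_deriv_le_of_injOn_ball_of_notMem (by linarith) (hd.mono hx') (hinj.mono hx')
        fun y hy => hw y (hx' hy))
    (mem_ball_self (by linarith)) hz
  have hLn : ‖L z - L c‖ ≤ 96 * 4 := by
    refine hmv.trans ?_
    rw [mem_ball, dist_eq_norm] at hz
    calc 96 * 4 / (R / 2) * ‖z - c‖ ≤ 96 * 4 / (R / 2) * (R / 2) := by gcongr
      _ = _ := by field_simp
  rw [← hexp z (hsub hz), ← hexp c (mem_ball_self hR)]
  calc ‖Complex.exp (L z)‖ = ‖Complex.exp (L z - L c)‖ * ‖Complex.exp (L c)‖ := by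
        rw [← norm_mul, ← Complex.exp_add, sub_add_cancel]
    _ ≤ _ := by
        gcongr
        exact (Complex.norm_exp_le_exp_norm _).trans (Real.exp_le_exp.2 hLn)

/-- A growth theorem for univalent functions, with a non-optimal constant. -/
theorem norm_sub_le_of_injOn_ball {g : ℂ → ℂ} {c : ℂ} {R : ℝ} (hR : 0 < R)
    (hd : DifferentiableOn ℂ g (ball c R)) (hinj : InjOn g (ball c R))
    {z : ℂ} (hz : z ∈ ball c (R / 4)) :
    ‖g z - g c‖ ≤ (1 + Real.exp (96 * 4)) * (‖deriv g c‖ * R) := by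
  have hcR : c ∈ ball c R := mem_ball_self hR
  have hnhds : ball c R ∈ 𝓝 c := ball_mem_nhds c hR
  have hds : DifferentiableOn ℂ (dslope g c) (ball c R) :=
    (Complex.differentiableOn_dslope hnhds).2 hd
  have hd0 : deriv g c ≠ 0 := deriv_ne_zero_of_injOn hnhds (hd.analyticAt hnhds) hinj
  have hne : ∀ x ∈ ball c R, dslope g c x ≠ 0 := by
    intro x hx
    rcases eq_or_ne x c with rfl | hxc
    · rwa [dslope_same]
    · rw [dslope_of_ne _ hxc, slope_def_field]
      exact div_ne_zero (sub_ne_zero.2 fun h => hxc (hinj hx hcR h)) (sub_ne_zero.2 hxc)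
  have hsub : closedBall c (R / 2) ⊆ ball c R := closedBall_subset_ball (by linarith)
  obtain ⟨q, hq, hmax⟩ := Complex.exists_mem_frontier_isMaxOn_norm (isBounded_ball (x := c))
    ⟨c, mem_ball_self (by linarith : 0 < R / 2)⟩
    (((hds.inv hne).mono hsub).diffContOnCl_ball subset_rfl)
  rw [frontier_ball c (by linarith)] at hq
  have hqR : q ∈ ball c R := hsub (sphere_subset_closedBall hq)
  have hqc : q ≠ c := ne_of_mem_sphere hq (by linarith)
  have hle : ‖(dslope g c c)⁻¹‖ ≤ ‖(dslope g c q)⁻¹‖ :=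
    hmax (subset_closure (mem_ball_self (by linarith : 0 < R / 2)))
  rw [norm_inv, norm_inv, inv_le_inv₀ (norm_pos_iff.2 (hne c hcR)) (norm_pos_iff.2 (hne q hqR)),
    dslope_same, dslope_of_ne _ hqc, slope_def_field, norm_div, ← dist_eq_norm q c,
    mem_sphere.1 hq, div_le_iff₀ (by linarith), norm_sub_rev] at hle
  have hsub2 : ball c (R / 2) ⊆ ball c R := ball_subset_ball (by linarith)
  have hz' := norm_sub_le_of_injOn_ball_of_notMem (w := g q) (by linarith : 0 < R / 2)
    (hd.mono hsub2) (hinj.mono hsub2) (fun x hx h => by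
      have := hinj (hsub2 hx) hqR h
      rw [this, mem_ball, mem_sphere.1 hq] at hx
      exact lt_irrefl _ hx) (z := z) (by rwa [show R / 2 / 2 = R / 4 by ring])
  calc ‖g z - g c‖ ≤ ‖g z - g q‖ + ‖g c - g q‖ := by
        rw [← sub_sub_sub_cancel_right _ _ (g q)]; exact norm_sub_le _ _
    _ ≤ (1 + Real.exp (96 * 4)) * ‖g c - g q‖ := by linarith
    _ ≤ _ := by
        gcongr
        refine hle.trans ?_
        gcongr
        linarith

/-- Local boundedness of a family of univalent functions propagates through a domain. -/
theorem locallyBounded_of_injOn {V : Set ℂ} (hV : IsOpen V) (hVc : IsPreconnected V)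
    {ι : Type*} {g : ι → ℂ → ℂ} (hd : ∀ i, DifferentiableOn ℂ (g i) V)
    (hinj : ∀ i, InjOn (g i) V) {b : ℂ} (hb : b ∈ V)
    (hbd : ∃ r > 0, ∃ M, ∀ i, ∀ w ∈ ball b r, ‖g i w‖ ≤ M) {z : ℂ} (hz : z ∈ V) :
    ∃ r > 0, ∃ M, ∀ i, ∀ w ∈ ball z r, ‖g i w‖ ≤ M := by
  set S := {z : ℂ | ∃ r > 0, ∃ M, ∀ i, ∀ w ∈ ball z r, ‖g i w‖ ≤ M} with hS
  have hSo : IsOpen S := by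
    refine Metric.isOpen_iff.2 fun x ⟨r, hr, M, hM⟩ => ⟨r / 2, by linarith, fun y hy => ?_⟩
    refine ⟨r / 2, by linarith, M, fun i w hw => hM i w (ball_subset_ball' ?_ hw)⟩
    rw [mem_ball] at hy
    linarith
  refine hVc.subset_of_closure_inter_subset hSo ⟨b, hb, hbd⟩ ?_ hz
  rintro x ⟨hxS, hxV⟩
  obtain ⟨R, hR, hRV⟩ := Metric.isOpen_iff.1 hV x hxV
  obtain ⟨y, ⟨r, hr, M, hM⟩, hxy⟩ := Metric.mem_closure_iff.1 hxS (R / 16) (by linarith)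
  have hyR : ball y (R / 2) ⊆ V := (ball_subset_ball' (by rw [dist_comm]; linarith)).trans hRV
  set s := min (r / 2) (R / 4) with hs
  have hs0 : 0 < s := lt_min (by linarith) (by linarith)
  have hsr : closedBall y s ⊆ ball y r := closedBall_subset_ball
    (lt_of_le_of_lt (min_le_left _ _) (by linarith))
  have hsV : closedBall y s ⊆ V := (closedBall_subset_ball
    (lt_of_le_of_lt (min_le_right _ _) (by linarith))).trans hyR
  refine ⟨R / 16, by linarith, (1 + Real.exp (96 * 4)) * (M / s * (R / 2)) + M,
    fun i w hw => ?_⟩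
  have hder : ‖deriv (g i) y‖ ≤ M / s :=
    Complex.norm_deriv_le_of_forall_mem_sphere_norm_le hs0
      (((hd i).mono hsV).diffContOnCl_ball subset_rfl)
      fun u hu => hM i u (hsr (sphere_subset_closedBall hu))
  have hgr := norm_sub_le_of_injOn_ball (by linarith : 0 < R / 2) ((hd i).mono hyR)
    ((hinj i).mono hyR) (z := w) (by
      have := dist_triangle w x y
      rw [mem_ball] at hw ⊢
      linarith)
  have hy := hM i y (mem_ball_self hr)
  calc ‖g i w‖ ≤ ‖g i w - g i y‖ + ‖g i y‖ := by
        simpa using norm_add_le (g i w - g i y) (g i y)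
    _ ≤ _ := by
        gcongr
        exact hgr.trans (by gcongr)

/-- Montel's theorem: a locally bounded sequence of holomorphic functions has a locally uniformly
convergent subsequence. -/
theorem exists_subseq_tendstoLocallyUniformlyOn {V : Set ℂ} (hV : IsOpen V)
    {g : ℕ → ℂ → ℂ} (hd : ∀ n, DifferentiableOn ℂ (g n) V)
    (hbd : ∀ z ∈ V, ∃ r > 0, ∃ M, ∀ n, ∀ w ∈ ball z r, ‖g n w‖ ≤ M) :
    ∃ φ : ℕ → ℕ, StrictMono φ ∧ ∃ G : ℂ → ℂ,
      TendstoLocallyUniformlyOn (fun k => g (φ k)) G atTop V := by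
  classical
  have hloc : ∀ z : V, ∃ r > 0, ∃ M, (∀ n, ‖g n z‖ ≤ M) ∧
      ∀ n, ∀ w ∈ ball (z : ℂ) r, dist (g n w) (g n z) ≤ 2 * M / r * dist w z := by
    rintro ⟨z, hz⟩
    obtain ⟨r, hr, M, hM⟩ := hbd z hz
    obtain ⟨s, hs, hsV⟩ := Metric.isOpen_iff.1 hV z hz
    have hm := lt_min hr hs
    refine ⟨min r s, hm, M, fun n => hM n z (mem_ball_self hr), fun n w hw => ?_⟩
    refine Complex.dist_le_div_mul_dist_of_mapsTo_ball
      ((hd n).mono ((ball_subset_ball (min_le_right _ _)).trans hsV)) (fun u hu => ?_) hw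
    rw [mem_closedBall, dist_eq_norm]
    linarith [norm_sub_le (g n u) (g n z), hM n z (mem_ball_self hr),
      hM n u (ball_subset_ball (min_le_left _ _) hu)]
  choose r hr M hM hlip using hloc
  have : LocallyCompactSpace V := hV.locallyCompactSpace
  set T : Set (V → ℂ) := {h | ∀ z, h z ∈ closedBall (0 : ℂ) (M z) ∧
    ∀ w : V, (w : ℂ) ∈ ball (z : ℂ) (r z) →
      dist (h w) (h z) ≤ 2 * M z / r z * dist (w : ℂ) z} with hT
  have hlim : ∀ z : V, Tendsto (fun w : V => 2 * M z / r z * dist (w : ℂ) z) (𝓝 z) (𝓝 0) := by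
    intro z
    have : Continuous fun w : V => 2 * M z / r z * dist (w : ℂ) z := by fun_prop
    simpa using! this.tendsto z
  have hnear : ∀ z : V, ∀ᶠ w : V in 𝓝 z, (w : ℂ) ∈ ball (z : ℂ) (r z) := fun z =>
    continuous_subtype_val.continuousAt (ball_mem_nhds _ (hr z))
  have hTcont : ∀ h ∈ T, Continuous h := by
    refine fun h hh => continuous_iff_continuousAt.2 fun z => ?_
    refine tendsto_iff_dist_tendsto_zero.2 (squeeze_zero' (.of_forall fun _ => dist_nonneg) ?_
      (hlim z))
    filter_upwards [hnear z] with w hw using (hh z).2 w hw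
  have hTcomp : IsCompact T := by
    refine (isCompact_univ_pi fun z : V => isCompact_closedBall (0 : ℂ) (M z)).of_isClosed_subset
      ?_ fun h hh z _ => (hh z).1
    simp only [hT, ofPred_forall, ofPred_and]
    refine isClosed_iInter fun z => (isClosed_closedBall.preimage (continuous_apply z)).inter
      (isClosed_iInter fun w => isClosed_iInter fun _ => isClosed_le (by fun_prop) (by fun_prop))
  set S : Set C(V, ℂ) := {h | (h : V → ℂ) ∈ T} with hSdef
  have hST : ContinuousMap.toFun '' S = T := by
    ext h
    constructor
    · rintro ⟨k, hk, rfl⟩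
      exact hk
    · exact fun hh => ⟨⟨h, hTcont h hh⟩, hh, rfl⟩
  have hScomp : IsCompact S := by
    refine ArzelaAscoli.isCompact_of_equicontinuous S (hST ▸ hTcomp) fun z => ?_
    refine Metric.equicontinuousAt_of_continuity_modulus _ (hlim z) _ ?_
    filter_upwards [hnear z] with w hw h
    rw [dist_comm]
    exact (h.2 z).2 w hw
  let u : ℕ → C(V, ℂ) := fun n => ⟨fun z => g n z, (hd n).continuousOn.domRestrict⟩
  have hu : ∀ n, u n ∈ S := fun n z =>
    ⟨by simpa using! hM z n, fun w hw => hlip z n w hw⟩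
  obtain ⟨G, -, φ, hφ, hG⟩ := hScomp.isSeqCompact hu
  refine ⟨φ, hφ, fun z => if h : z ∈ V then G ⟨z, h⟩ else 0, ?_⟩
  rw [tendstoLocallyUniformlyOn_iff_tendstoLocallyUniformly_comp_coe]
  convert! ContinuousMap.tendsto_iff_tendstoLocallyUniformly.1 hG using 1
  ext z
  simp

/-- Hurwitz's theorem: a locally uniform limit of univalent functions is univalent, provided its
derivative does not vanish at some point. -/
theorem injOn_of_tendstoLocallyUniformlyOn {V : Set ℂ} (hV : IsOpen V)
    (hVc : IsPreconnected V) {g : ℕ → ℂ → ℂ} {G : ℂ → ℂ}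
    (hd : ∀ n, DifferentiableOn ℂ (g n) V) (hinj : ∀ n, InjOn (g n) V)
    (hG : TendstoLocallyUniformlyOn g G atTop V) {b : ℂ} (hb : b ∈ V) (hGb : deriv G b ≠ 0) :
    InjOn G V := by
  have hGd : DifferentiableOn ℂ G V := hG.differentiableOn (.of_forall hd) hV
  have key : ∀ x ∈ V, ∀ δ > 0, ∀ᶠ n in atTop, ∃ z ∈ ball x δ ∩ V, g n z = G x := by
    intro x hx δ hδ
    have hGx : ∀ᶠ z in 𝓝[≠] x, G z ≠ G x := by
      refine ((hGd.analyticAt (hV.mem_nhds hx)).eventually_eq_or_eventually_ne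
        analyticAt_const).resolve_left fun h => hGb ?_
      have heq := (hGd.analyticOnNhd hV).eqOn_of_preconnected_of_eventuallyEq
        analyticOnNhd_const hVc hx h
      rw [(heq.eventuallyEq_of_mem (hV.mem_nhds hb)).deriv_eq]
      simp
    rw [eventually_nhdsWithin_iff] at hGx
    obtain ⟨s, hs, hsb⟩ := Metric.eventually_nhds_iff_ball.1
      (hGx.and ((hV.eventually_mem hx).and (ball_mem_nhds x hδ)))
    have hsub : closedBall x (s / 2) ⊆ ball x s := closedBall_subset_ball (by linarith)
    have hsubV : closedBall x (s / 2) ⊆ V := fun z hz => (hsb z (hsub hz)).2.1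
    have hs2 : 0 < s / 2 := by linarith
    obtain ⟨q, hq, hmin⟩ := (isCompact_sphere x (s / 2)).exists_isMinOn
      (NormedSpace.sphere_nonempty.2 hs2.le)
      (((hGd.continuousOn.mono (sphere_subset_closedBall.trans hsubV)).sub
        continuousOn_const).norm (f := fun z => G z - G x))
    have hε : 0 < ‖G q - G x‖ := norm_pos_iff.2 (sub_ne_zero.2
      ((hsb q (hsub (sphere_subset_closedBall hq))).1 (ne_of_mem_sphere hq hs2.ne')))
    set ε := ‖G q - G x‖ with hεdef
    have hunif := (tendstoLocallyUniformlyOn_iff_forall_isCompact hV).1 hG _ hsubV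
      (isCompact_closedBall x (s / 2))
    filter_upwards [Metric.tendstoUniformlyOn_iff.1 hunif (ε / 6) (by linarith)] with n hn
    have hnx := hn x (mem_closedBall_self hs2.le)
    have hlow : ∀ z ∈ sphere x (s / 2), ε / 2 ≤ ‖g n z - g n x‖ := by
      intro z hz
      have h1 : ε ≤ dist (G z) (G x) := by rw [dist_eq_norm]; exact hmin hz
      have h2 := hn z (sphere_subset_closedBall hz)
      have h3 := dist_triangle4 (G z) (g n z) (g n x) (G x)
      rw [dist_comm (g n x)] at h3
      rw [← dist_eq_norm]
      linarith
    have hfreq : ∃ᶠ z in 𝓝 x, g n z ≠ g n x := by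
      have : ∀ᶠ z in 𝓝[≠] x, g n z ≠ g n x := by
        filter_upwards [(hV.eventually_mem hx).filter_mono nhdsWithin_le_nhds,
          self_mem_nhdsWithin] with z hz hzx h
        exact hzx (hinj n hz hx h)
      exact this.frequently.filter_mono nhdsWithin_le_nhds
    obtain ⟨z, hz, hzG⟩ := (((hd n).mono hsubV).diffContOnCl_ball
      subset_rfl).ball_subset_image_closedBall hs2 hlow hfreq
      (show G x ∈ ball (g n x) (ε / 2 / 2) by rw [mem_ball]; linarith)
    exact ⟨z, ⟨(hsb z (hsub hz)).2.2, hsubV hz⟩, hzG⟩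
  intro x hx y hy hxy
  by_contra hne
  have hδ : 0 < dist x y / 2 := by have := dist_pos.2 hne; linarith
  obtain ⟨n, ⟨z, hz, hzx⟩, ⟨w, hw, hwy⟩⟩ := ((key x hx _ hδ).and (key y hy _ hδ)).exists
  have hzw : z = w := hinj n hz.2 hw.2 (by rw [hzx, hwy, hxy])
  subst hzw
  exact (ball_disjoint_ball (by linarith)).le_bot ⟨hz.1, hw.1⟩

end Univalent

/-- Normalization of a degenerating sequence of univalent maps: if univalent `fₙ : V → ℂ`
converge uniformly to the constant `a`, `fₙ(bₙ) = a` and `bₙ → b ∈ V`, then the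
normalized maps `Fₙ(z) = (fₙ(z) - a)/fₙ'(bₙ)` satisfy `Fₙ(bₙ) = 0`, `Fₙ'(bₙ) = 1`, and
some subsequence converges locally uniformly on `V` to a univalent `F` with `F(b) = 0`,
`F'(b) = 1`. -/
theorem stmt_16 (V : Set ℂ) (hV : IsOpen V) (hVc : IsConnected V)
    (f : ℕ → ℂ → ℂ) (hdiff : ∀ n, DifferentiableOn ℂ (f n) V)
    (hinj : ∀ n, Set.InjOn (f n) V)
    (a : ℂ) (hconv : TendstoUniformlyOn f (fun _ => a) atTop V)
    (b : ℂ) (hb : b ∈ V) (bn : ℕ → ℂ) (hbn : ∀ n, bn n ∈ V)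
    (hfb : ∀ n, f n (bn n) = a) (hbnb : Tendsto bn atTop (nhds b)) :
    (∀ n, (fun z => (f n z - a) / deriv (f n) (bn n)) (bn n) = 0 ∧
      deriv (fun z => (f n z - a) / deriv (f n) (bn n)) (bn n) = 1) ∧
    ∃ φ : ℕ → ℕ, StrictMono φ ∧ ∃ F : ℂ → ℂ,
      DifferentiableOn ℂ F V ∧ Set.InjOn F V ∧ F b = 0 ∧ deriv F b = 1 ∧
      TendstoLocallyUniformlyOn
        (fun k z => (f (φ k) z - a) / deriv (f (φ k)) (bn (φ k))) F atTop V := by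
  have hne : ∀ n, deriv (f n) (bn n) ≠ 0 := fun n =>
    deriv_ne_zero_of_injOn (hV.mem_nhds (hbn n)) ((hdiff n).analyticAt (hV.mem_nhds (hbn n)))
      (hinj n)
  set g : ℕ → ℂ → ℂ := fun n z => (f n z - a) / deriv (f n) (bn n) with hg
  have hg0 : ∀ n, g n (bn n) = 0 := fun n => by simp [hg, hfb n]
  have hg1 : ∀ n, deriv (g n) (bn n) = 1 := fun n => by
    simp only [hg, deriv_div_const, deriv_sub_const, div_self (hne n)]
  have hgd : ∀ n, DifferentiableOn ℂ (g n) V := fun n => ((hdiff n).sub_const a).div_const _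
  have hginj : ∀ n, Set.InjOn (g n) V := fun n x hx y hy hxy =>
    hinj n hx hy (sub_left_injective ((div_left_inj' (hne n)).1 hxy))
  refine ⟨fun n => ⟨hg0 n, hg1 n⟩, ?_⟩
  obtain ⟨R, hR, hRV⟩ := Metric.isOpen_iff.1 hV b hb
  obtain ⟨N, hN⟩ := Metric.tendsto_atTop.1 hbnb (R / 16) (by linarith)
  have hbd : ∃ r > 0, ∃ M, ∀ k, ∀ w ∈ Metric.ball b r, ‖g (k + N) w‖ ≤ M := by
    refine ⟨R / 16, by linarith, (1 + Real.exp (96 * 4)) * (1 * (R / 2)), fun k w hw => ?_⟩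
    have hk := hN (k + N) (by omega)
    have hsub : Metric.ball (bn (k + N)) (R / 2) ⊆ V :=
      (Metric.ball_subset_ball' (by linarith)).trans hRV
    have := norm_sub_le_of_injOn_ball (by linarith : 0 < R / 2) ((hgd (k + N)).mono hsub)
      ((hginj (k + N)).mono hsub) (z := w) (by
        have := dist_triangle_right w (bn (k + N)) b
        rw [Metric.mem_ball] at hw ⊢
        linarith)
    rwa [hg0, hg1, sub_zero, norm_one] at this
  obtain ⟨ψ, hψ, F, hF⟩ := exists_subseq_tendstoLocallyUniformlyOn hV
    (fun k => hgd (k + N)) fun z hz => locallyBounded_of_injOn hV hVc.isPreconnected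
      (fun k => hgd (k + N)) (fun k => hginj (k + N)) hb hbd hz
  have hφ : StrictMono fun k => ψ k + N := hψ.add_const N
  have hFd : DifferentiableOn ℂ F V := hF.differentiableOn (.of_forall fun k => hgd _) hV
  have hlim : Tendsto (fun k => bn (ψ k + N)) atTop (nhdsWithin b V) :=
    tendsto_nhdsWithin_iff.2 ⟨hbnb.comp hφ.tendsto_atTop, .of_forall fun k => hbn _⟩
  have hFb : F b = 0 := by
    have := hF.tendsto_comp (hFd.continuousOn b hb) hb hlim
    simp only [hg0] at this
    exact tendsto_nhds_unique this tendsto_const_nhds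
  have hFb' : deriv F b = 1 := by
    have := (hF.deriv (.of_forall fun k => hgd _) hV).tendsto_comp
      ((hFd.deriv hV).continuousOn b hb) hb hlim
    simp only [Function.comp_apply, hg1] at this
    exact tendsto_nhds_unique this tendsto_const_nhds
  exact ⟨fun k => ψ k + N, hφ, F, hFd,
    injOn_of_tendstoLocallyUniformlyOn hV hVc.isPreconnected (fun k => hgd _)
      (fun k => hginj _) hF hb (by rw [hFb']; exact one_ne_zero), hFb, hFb', hF⟩
end

section
/- Let A ⊆ ℂ be a dense connected set and let L, l be two simple unbounded curves in ℂ, both disjoint from A, both containing a common unbounded sequence of points (cₙ) with cₙ ∈ L ∩ l for all n. If L ≠ l as sets, then A is not connected or not dense — i.e., under the standing assumptions that A is dense and connected, any two simple curves disjoint from A and passing through a common sequence of points accumulating appropriately must coincide. Formally: if x, y ∈ ℂ and γ₁, γ₂ are two arcs from x to y, each disjoint from the dense connected set A, then γ₁ = γ₂ as sets. -/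
open scoped unitInterval

/-- A continuous logarithm of `(z - γ 0) / (z - γ 1)` off the range of a path `γ`. -/
lemma exists_continuousOn_log_off_path (γ : C(I, ℂ)) :
    ∃ g : ℂ → ℂ, ContinuousOn g (Set.range γ)ᶜ ∧
      ∀ z ∉ Set.range γ, (z - γ 1) * Complex.exp (g z) = z - γ 0 := by
  have hne (t : I) (z : ((Set.range γ)ᶜ : Set ℂ)) : (z : ℂ) - γ t ≠ 0 :=
    fun h ↦ z.2 ⟨t, (sub_eq_zero.mp h).symm⟩
  let H : C(I × ((Set.range γ)ᶜ : Set ℂ), {z : ℂ // z ≠ 0}) :=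
    ⟨fun p ↦ ⟨((p.2 : ℂ) - γ 0) / ((p.2 : ℂ) - γ p.1),
        div_ne_zero (hne 0 p.2) (hne p.1 p.2)⟩, by
      refine Continuous.subtype_mk (Continuous.div (by fun_prop) (by fun_prop) ?_) _
      exact fun p ↦ hne p.1 p.2⟩
  have H_zero (z) : H (0, z) = ⟨_, Complex.exp_ne_zero ((0 : C(((Set.range γ)ᶜ : Set ℂ), ℂ)) z)⟩ := by
    apply Subtype.ext
    simp [H, div_self (hne 0 z)]
  let L := Complex.isCoveringMap_exp.liftHomotopy H 0 H_zero
  have hL (p) : Complex.exp (L p) = H p :=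
    congrArg Subtype.val (congrFun (Complex.isCoveringMap_exp.liftHomotopy_lifts H 0 H_zero) p)
  classical
  refine ⟨fun z ↦ if hz : z ∈ (Set.range γ)ᶜ then L (1, ⟨z, hz⟩) else 0, ?_, fun z hz ↦ ?_⟩
  · rw [continuousOn_iff_continuous_domRestrict]
    have : Continuous fun z : ((Set.range γ)ᶜ : Set ℂ) ↦ L (1, z) := by fun_prop
    convert this using 2 with z
    exact dif_pos z.2
  · have h := hL (1, ⟨z, hz⟩)
    have h0 := hne 1 ⟨z, hz⟩
    beta_reduce
    rw [dif_pos (show z ∈ (Set.range γ)ᶜ from hz), h]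
    simp only [H, ContinuousMap.coe_mk]
    field_simp

/-- Two continuous logarithms of the same function on a preconnected set differ by a constant. -/
lemma IsPreconnected.sub_eq_sub_of_exp_eqOn {X : Type*} [TopologicalSpace X] {s : Set X}
    (hs : IsPreconnected s) {f g : X → ℂ} (hf : ContinuousOn f s) (hg : ContinuousOn g s)
    (h : ∀ x ∈ s, Complex.exp (f x) = Complex.exp (g x)) {a x : X} (ha : a ∈ s) (hx : x ∈ s) :
    f x - g x = f a - g a := by
  have key := Complex.isCoveringMap_exp.eqOn_of_comp_eqOn hs hf
    (hg.add (continuousOn_const (c := f a - g a))) (fun y hy ↦ Subtype.ext ?_) ha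
    (by simp) hx
  · simp only [Pi.add_apply] at key
    linear_combination key
  · simp [Complex.exp_add, Complex.exp_sub, h y hy, h a ha]

/-- The function `(z - a) / (z - b)` has no continuous logarithm on the plane minus `{a, b}`. -/
lemma not_exists_continuousOn_log_sub_div_sub {a b : ℂ} (hab : a ≠ b) {G : ℂ → ℂ}
    (hG : ContinuousOn G {a, b}ᶜ)
    (hexp : ∀ z ∈ ({a, b} : Set ℂ)ᶜ, (z - b) * Complex.exp (G z) = z - a) : False := by
  have hd : a - b ≠ 0 := sub_ne_zero.mpr hab
  let e : ℝ → ℂ := fun θ ↦ Complex.exp (θ * Complex.I)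
  have he : Continuous e := by fun_prop
  have hnorm (θ : ℝ) : ‖e θ‖ = 1 := Complex.norm_exp_ofReal_mul_I θ
  have hslit (θ : ℝ) : 1 + e θ / 2 ∈ Complex.slitPlane :=
    Complex.mem_slitPlane_of_norm_lt_one (by rw [norm_div, hnorm]; norm_num)
  let z : ℝ → ℂ := fun θ ↦ a + (a - b) * (e θ / 2)
  have hzb (θ : ℝ) : z θ - b = (a - b) * (1 + e θ / 2) := by simp only [z]; ring
  have hz (θ : ℝ) : z θ ∈ ({a, b} : Set ℂ)ᶜ := by
    rintro (h | h)
    · have : (a - b) * (e θ / 2) = 0 := by simpa [z] using h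
      simp [hd, e, Complex.exp_ne_zero] at this
    · have h' := hzb θ
      rw [Set.mem_singleton_iff.mp h, sub_self] at h'
      exact mul_ne_zero hd (Complex.slitPlane_ne_zero (hslit θ)) h'.symm
  have hf : Continuous fun θ ↦ G (z θ) + Complex.log (1 + e θ / 2) :=
    (hG.comp_continuous (by fun_prop) hz).add
      (Continuous.clog (by fun_prop) hslit)
  have hg : Continuous fun θ : ℝ ↦ (θ : ℂ) * Complex.I - Complex.log 2 := by fun_prop
  have key := isPreconnected_univ.sub_eq_sub_of_exp_eqOn hf.continuousOn hg.continuousOn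
    (fun θ _ ↦ ?_) (Set.mem_univ 0) (Set.mem_univ (2 * Real.pi))
  · have h2 : e (2 * Real.pi) = e 0 := by simp [e, Complex.exp_two_pi_mul_I]
    simp only [z, h2] at key
    refine Complex.two_pi_I_ne_zero ?_
    push_cast at key
    linear_combination -key
  · have h := hexp _ (hz θ)
    rw [hzb] at h
    rw [Complex.exp_add, Complex.exp_log (Complex.slitPlane_ne_zero (hslit θ)), Complex.exp_sub,
      Complex.exp_log two_ne_zero]
    apply mul_left_cancel₀ hd
    simp only [z, e] at h ⊢
    linear_combination h

/-- Two paths with the same distinct endpoints which meet only there cannot both avoid a dense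
preconnected subset of the plane. -/
lemma false_of_paths_avoiding_dense_preconnected {A : Set ℂ} (hdense : Dense A)
    (hconn : IsPreconnected A) {a b : ℂ} (hab : a ≠ b) {p q : C(I, ℂ)}
    (hp0 : p 0 = a) (hp1 : p 1 = b) (hq0 : q 0 = a) (hq1 : q 1 = b)
    (hpq : Set.range p ∩ Set.range q ⊆ {a, b})
    (hpA : A ⊆ (Set.range p)ᶜ) (hqA : A ⊆ (Set.range q)ᶜ) : False := by
  obtain ⟨g, hg, hgexp⟩ := exists_continuousOn_log_off_path p
  obtain ⟨h, hh, hhexp⟩ := exists_continuousOn_log_off_path q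
  have hpo : IsOpen (Set.range p)ᶜ := (isCompact_range p.continuous).isClosed.isOpen_compl
  have hqo : IsOpen (Set.range q)ᶜ := (isCompact_range q.continuous).isClosed.isOpen_compl
  rw [hp0, hp1] at hgexp
  rw [hq0, hq1] at hhexp
  obtain ⟨x₀, hx₀⟩ := hdense.nonempty
  have hexp_eq : ∀ z ∈ (Set.range p)ᶜ ∩ (Set.range q)ᶜ,
      Complex.exp (g z) = Complex.exp (h z) := fun z hz ↦ by
    have hzb : z - b ≠ 0 := fun e ↦ hz.1 ⟨1, hp1.trans (sub_eq_zero.mp e).symm⟩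
    exact mul_left_cancel₀ hzb ((hgexp z hz.1).trans (hhexp z hz.2).symm)
  have hsub : ∀ z ∈ A, g z = h z + (g x₀ - h x₀) := fun z hz ↦ by
    have := hconn.sub_eq_sub_of_exp_eqOn (hg.mono hpA) (hh.mono hqA)
      (fun w hw ↦ hexp_eq w ⟨hpA hw, hqA hw⟩) hx₀ hz
    linear_combination this
  have hh' : ContinuousOn (fun z ↦ h z + (g x₀ - h x₀)) (Set.range q)ᶜ :=
    hh.add continuousOn_const
  have heq : Set.EqOn g (fun z ↦ h z + (g x₀ - h x₀)) ((Set.range p)ᶜ ∩ (Set.range q)ᶜ) :=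
    Set.EqOn.of_subset_closure (s := A) hsub (hg.mono Set.inter_subset_left)
      (hh'.mono Set.inter_subset_right) (fun z hz ↦ ⟨hpA hz, hqA hz⟩)
      (by simp [hdense.closure_eq])
  classical
  let G : ℂ → ℂ := fun z ↦ if z ∈ Set.range p then h z + (g x₀ - h x₀) else g z
  have hGp : Set.EqOn G g (Set.range p)ᶜ := fun z hz ↦ if_neg hz
  have hGq : Set.EqOn G (fun z ↦ h z + (g x₀ - h x₀)) (Set.range q)ᶜ := fun z hz ↦ by
    by_cases hzp : z ∈ Set.range p
    · exact if_pos hzp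
    · exact (if_neg hzp).trans (heq ⟨hzp, hz⟩)
  have hcover : ∀ z ∈ ({a, b} : Set ℂ)ᶜ, z ∈ (Set.range p)ᶜ ∨ z ∈ (Set.range q)ᶜ := fun z hz ↦ by
    by_contra! hcon
    exact hz (hpq ⟨not_not.mp hcon.1, not_not.mp hcon.2⟩)
  refine not_exists_continuousOn_log_sub_div_sub hab (G := G) (fun z hz ↦ ?_) (fun z hz ↦ ?_)
  · rcases hcover z hz with hz | hz
    · exact ((hg.congr hGp).continuousAt (hpo.mem_nhds hz)).continuousWithinAt
    · exact ((hh'.congr hGq).continuousAt (hqo.mem_nhds hz)).continuousWithinAt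
  · rcases hcover z hz with hz | hz
    · rw [hGp hz, hgexp z hz]
    · have h1 := hexp_eq x₀ ⟨hpA hx₀, hqA hx₀⟩
      rw [hGq hz, Complex.exp_add, Complex.exp_sub, h1, div_self (Complex.exp_ne_zero _), mul_one,
        hhexp z hz]

lemma ContinuousOn.exists_subpath {f : ℝ → ℂ} {u v : ℝ} (hf : ContinuousOn f (Set.uIcc u v)) :
    ∃ p : C(I, ℂ), p 0 = f u ∧ p 1 = f v ∧ Set.range p ⊆ f '' Set.uIcc u v := by
  have hmem (t : I) : AffineMap.lineMap u v (t : ℝ) ∈ Set.uIcc u v := by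
    rw [← segment_eq_uIcc, segment_eq_image_lineMap]
    exact ⟨t, t.2, rfl⟩
  refine ⟨⟨fun t ↦ f (AffineMap.lineMap u v (t : ℝ)), hf.comp_continuous ?_ hmem⟩, ?_, ?_, ?_⟩
  · exact AffineMap.lineMap_continuous.comp continuous_subtype_val
  · simp
  · simp
  · rintro _ ⟨t, rfl⟩
    exact ⟨_, hmem t, rfl⟩

lemma image_subset_image_of_disjoint_dense_preconnected {A : Set ℂ} (hdense : Dense A)
    (hconn : IsPreconnected A) {f g : ℝ → ℂ}
    (hf : ContinuousOn f (Set.Icc 0 1)) (hfi : Set.InjOn f (Set.Icc 0 1))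
    (hg : ContinuousOn g (Set.Icc 0 1)) (h0 : f 0 = g 0) (h1 : f 1 = g 1)
    (hfA : f '' Set.Icc 0 1 ∩ A = ∅) (hgA : g '' Set.Icc 0 1 ∩ A = ∅) :
    f '' Set.Icc 0 1 ⊆ g '' Set.Icc 0 1 := by
  rintro _ ⟨s, hs, rfl⟩
  by_contra hsg
  have hT : IsCompact (Set.Icc 0 1 ∩ f ⁻¹' (g '' Set.Icc 0 1)) :=
    isCompact_Icc.of_isClosed_subset (hf.preimage_isClosed_of_isClosed isClosed_Icc
      (isCompact_Icc.image_of_continuousOn hg).isClosed) Set.inter_subset_left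
  obtain ⟨c, ⟨⟨hc, hcg⟩, hcs⟩, hcmax⟩ := (hT.inter_right (isClosed_Iic (a := s))).exists_isGreatest
    ⟨0, ⟨by simp, 0, by simp, h0.symm⟩, hs.1⟩
  obtain ⟨d, ⟨⟨hd, hdg⟩, hsd⟩, hdmin⟩ := (hT.inter_right (isClosed_Ici (a := s))).exists_isLeast
    ⟨1, ⟨by simp, 1, by simp, h1.symm⟩, hs.2⟩
  have hcd : c ≠ d := by
    rintro rfl
    have hsc : s = c := le_antisymm (Set.mem_Ici.mp hsd) (Set.mem_Iic.mp hcs)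
    exact hsg (hsc ▸ hcg)
  have hcd' : c ≤ d := le_trans hcs hsd
  obtain ⟨u, hu, huc⟩ := id hcg
  obtain ⟨v, hv, hvd⟩ := id hdg
  have hcdI : Set.uIcc c d ⊆ Set.Icc 0 1 := Set.uIcc_subset_Icc hc hd
  have huvI : Set.uIcc u v ⊆ Set.Icc 0 1 := Set.uIcc_subset_Icc hu hv
  obtain ⟨p, hp0, hp1, hp⟩ := (hf.mono hcdI).exists_subpath
  obtain ⟨q, hq0, hq1, hq⟩ := (hg.mono huvI).exists_subpath
  refine false_of_paths_avoiding_dense_preconnected hdense hconn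
    (fun h ↦ hcd (hfi hc hd h)) hp0 hp1 (hq0.trans huc) (hq1.trans hvd) ?_ ?_ ?_
  · rintro z ⟨hzp, hzq⟩
    obtain ⟨t, ht, rfl⟩ := hp hzp
    have htg : f t ∈ g '' Set.Icc 0 1 := Set.image_mono huvI (hq hzq)
    have htI := hcdI ht
    rw [Set.uIcc_of_le hcd'] at ht
    rcases le_total t s with hts | hst
    · exact Or.inl (congrArg f (le_antisymm (hcmax ⟨⟨htI, htg⟩, hts⟩) ht.1))
    · exact Or.inr (congrArg f (le_antisymm ht.2 (hdmin ⟨⟨htI, htg⟩, hst⟩)))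
  · exact fun z hz hzp ↦ hfA.subset ⟨Set.image_mono hcdI (hp hzp), hz⟩
  · exact fun z hz hzq ↦ hgA.subset ⟨Set.image_mono huvI (hq hzq), hz⟩


/-- Uniqueness mechanism: two arcs with the same endpoints, each disjoint from a dense
connected subset `A` of the plane, must coincide as sets. -/
theorem stmt_17 (A : Set ℂ) (hdense : Dense A) (hconn : IsConnected A)
    (x y : ℂ) (γ₁ γ₂ : ℝ → ℂ)
    (h₁c : ContinuousOn γ₁ (Set.Icc 0 1)) (h₁i : Set.InjOn γ₁ (Set.Icc 0 1))
    (h₁0 : γ₁ 0 = x) (h₁1 : γ₁ 1 = y) (h₁A : γ₁ '' Set.Icc 0 1 ∩ A = ∅)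
    (h₂c : ContinuousOn γ₂ (Set.Icc 0 1)) (h₂i : Set.InjOn γ₂ (Set.Icc 0 1))
    (h₂0 : γ₂ 0 = x) (h₂1 : γ₂ 1 = y) (h₂A : γ₂ '' Set.Icc 0 1 ∩ A = ∅) :
    γ₁ '' Set.Icc 0 1 = γ₂ '' Set.Icc 0 1 := by
  exact Set.Subset.antisymm
    (image_subset_image_of_disjoint_dense_preconnected hdense hconn.isPreconnected h₁c h₁i h₂c
      (h₁0.trans h₂0.symm) (h₁1.trans h₂1.symm) h₁A h₂A)
    (image_subset_image_of_disjoint_dense_preconnected hdense hconn.isPreconnected h₂c h₂i h₁c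
      (h₂0.trans h₁0.symm) (h₂1.trans h₁1.symm) h₂A h₁A)
end
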